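/- Fix an integer r ≥ 1. Let N(n,r) be the number of r-tuples (τ₁,...,τ_r) of monotone triangles of size n whose entry-wise infimum is τ_min, and let A(n) be the number of monotone triangles of size n. Then N(n,r) ~ r·A(n)^{r-1} as n → ∞; equivalently, the probability that r independent uniform monotone triangles have infimum τ_min is asymptotic to r/A(n). -/

import Mathlib

open Finset

/-- `τ` is a monotone triangle of size `n`: a triangular array `τ i j` (`1 ≤ j ≤ i ≤ n`)
of integers in `{1,…,n}` (normalized to be `0` outside the triangular domain),
with strictly increasing rows and the interlacing condition. -/
def IsMT (n : ℕ) (τ : ℕ → ℕ → ℕ) : Prop :=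
  (∀ i j, ¬(1 ≤ j ∧ j ≤ i ∧ i ≤ n) → τ i j = 0) ∧
  (∀ i j, 1 ≤ j → j ≤ i → i ≤ n → 1 ≤ τ i j ∧ τ i j ≤ n) ∧
  (∀ i j, 1 ≤ j → j < i → i ≤ n → τ i j < τ i (j + 1)) ∧
  (∀ i j, 1 ≤ j → j < i → i ≤ n → τ i j ≤ τ (i - 1) j ∧ τ (i - 1) j ≤ τ i (j + 1))

/-- Entry-wise comparison of triangular arrays of size `n`. -/
def MTle (n : ℕ) (τ σ : ℕ → ℕ → ℕ) : Prop :=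
  ∀ i j, 1 ≤ j → j ≤ i → i ≤ n → τ i j ≤ σ i j

/-- The number of monotone triangles of size `n`. -/
noncomputable def MTcount (n : ℕ) : ℕ := {τ | IsMT n τ}.ncard

/-- The minimal monotone triangle, `τ_min i j = j`. -/
def tmin (n : ℕ) : ℕ → ℕ → ℕ := fun i j => if 1 ≤ j ∧ j ≤ i ∧ i ≤ n then j else 0

/-- The maximal monotone triangle, `τ_max i j = n - i + j`. -/
def tmax (n : ℕ) : ℕ → ℕ → ℕ := fun i j => if 1 ≤ j ∧ j ≤ i ∧ i ≤ n then n - i + j else 0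

/-- Row `i` of `τ` is distinguished: its entries are `1, 2, …, i`. -/
def Distinguished (n : ℕ) (τ : ℕ → ℕ → ℕ) (i : ℕ) : Prop :=
  ∀ l, 1 ≤ l → l ≤ i → τ i l = l

/-- Rank reversal: replace each entry `x` by `n - x + 1` and reverse each row. -/
def bar (n : ℕ) (τ : ℕ → ℕ → ℕ) : ℕ → ℕ → ℕ :=
  fun i j => if 1 ≤ j ∧ j ≤ i ∧ i ≤ n then n - τ i (i - j + 1) + 1 else 0

/-- Entry-wise infimum of an `r`-tuple. -/
noncomputable def infTuple {r : ℕ} (τs : Fin r → ℕ → ℕ → ℕ) : ℕ → ℕ → ℕ :=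
  fun i j => ⨅ m, τs m i j

/-- Entry-wise supremum of an `r`-tuple. -/
noncomputable def supTuple {r : ℕ} (τs : Fin r → ℕ → ℕ → ℕ) : ℕ → ℕ → ℕ :=
  fun i j => ⨆ m, τs m i j


/-- Monotone triangles of size `n` for which every row `i` with `P i` is distinguished. -/
def mtS (n : ℕ) (P : ℕ → Prop) : Set (ℕ → ℕ → ℕ) :=
  {τ | IsMT n τ ∧ ∀ i, P i → τ i i ≤ i}

noncomputable def mtA (n : ℕ) (P : ℕ → Prop) : ℕ := (mtS n P).ncard

theorem mt_finite (n : ℕ) : {τ | IsMT n τ}.Finite := by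
  let F : (ℕ → ℕ → ℕ) → (Fin (n+1) → Fin (n+1) → Fin (n+1)) :=
    fun τ i j => Fin.ofNat (n+1) (τ i j)
  refine Set.Finite.of_injOn (f := F) (t := Set.univ) (fun _ _ => Set.mem_univ _) ?_ Set.finite_univ
  intro τ hτ σ hσ h
  obtain ⟨h1, h2, -, -⟩ := hτ
  obtain ⟨g1, g2, -, -⟩ := hσ
  funext i j
  by_cases hij : 1 ≤ j ∧ j ≤ i ∧ i ≤ n
  · have := congrFun (congrFun h ⟨i, by omega⟩) ⟨j, by omega⟩
    have := congrArg Fin.val this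
    simp only [F, Fin.ofNat] at this
    rwa [Nat.mod_eq_of_lt, Nat.mod_eq_of_lt] at this
    · have := g2 i j hij.1 hij.2.1 hij.2.2; omega
    · have := h2 i j hij.1 hij.2.1 hij.2.2; omega
  · rw [h1 i j hij, g1 i j hij]

theorem mtS_finite (n : ℕ) (P : ℕ → Prop) : (mtS n P).Finite :=
  (mt_finite n).subset (fun _ h => h.1)

theorem mtA_false (n : ℕ) : mtA n (fun _ => False) = MTcount n := by
  simp [mtA, mtS, MTcount]

theorem mtA_le (n : ℕ) (P : ℕ → Prop) : mtA n P ≤ MTcount n :=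
  Set.ncard_le_ncard (fun _ h => h.1) (mt_finite n)

theorem IsMT.le_entry {n : ℕ} {τ : ℕ → ℕ → ℕ} (h : IsMT n τ) (i j : ℕ) (h1 : 1 ≤ j) (h2 : j ≤ i)
    (h3 : i ≤ n) : j ≤ τ i j := by
  induction j, h1 using Nat.le_induction with
  | base => exact (h.2.1 i 1 le_rfl h2 h3).1
  | succ j hj ih =>
    have := h.2.2.1 i j hj (by omega) h3
    have := ih (by omega)
    omega

theorem IsMT.gap {n : ℕ} {τ : ℕ → ℕ → ℕ} (h : IsMT n τ) (i : ℕ) (h3 : i ≤ n) (d : ℕ) :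
    ∀ j, 1 ≤ j → j + d ≤ i → τ i j + d ≤ τ i (j + d) := by
  induction d with
  | zero => intros; simp
  | succ d ih =>
    intro j h1 h2
    have := ih j h1 (by omega)
    have := h.2.2.1 i (j + d) (by omega) (by omega) h3
    have e : j + (d + 1) = j + d + 1 := by omega
    rw [e]
    omega

theorem IsMT.dist_row {n : ℕ} {τ : ℕ → ℕ → ℕ} (h : IsMT n τ) (i : ℕ) (h3 : i ≤ n)
    (hd : τ i i ≤ i) (j : ℕ) (h1 : 1 ≤ j) (h2 : j ≤ i) : τ i j = j := by
  have := h.gap i h3 (i - j) j h1 (by omega)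
  have e : j + (i - j) = i := by omega
  rw [e] at this
  have := h.le_entry i j h1 h2 h3
  omega

theorem IsMT.last_row {n : ℕ} {τ : ℕ → ℕ → ℕ} (h : IsMT n τ)
    (j : ℕ) (h1 : 1 ≤ j) (h2 : j ≤ n) : τ n j = j :=
  h.dist_row n le_rfl (h.2.1 n n (by omega) le_rfl le_rfl).2 j h1 h2

/-- Entries weakly decrease down columns; below a distinguished row. -/
theorem IsMT.dist_below {n : ℕ} {τ : ℕ → ℕ → ℕ} (h : IsMT n τ) (k : ℕ) (hk : τ k k ≤ k)
    (d : ℕ) : ∀ j, 1 ≤ j → j ≤ k → k + d ≤ n → τ (k + d) j = j := by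
  induction d with
  | zero => intro j h1 h2 h3; exact h.dist_row k h3 hk j h1 h2
  | succ d ih =>
    intro j h1 h2 h3
    have a := ih j h1 h2 (by omega)
    have b := (h.2.2.2 (k + (d + 1)) j h1 (by omega) h3).1
    have c := h.le_entry (k + (d+1)) j h1 (by omega) h3
    have e : k + (d + 1) - 1 = k + d := by omega
    rw [e] at b
    omega

theorem IsMT.inf {n : ℕ} {τ σ : ℕ → ℕ → ℕ} (h : IsMT n τ) (g : IsMT n σ) : IsMT n (τ ⊓ σ) := by
  refine ⟨fun i j hh => ?_, fun i j a b c => ?_, fun i j a b c => ?_, fun i j a b c => ?_⟩ <;>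
    simp only [Pi.inf_apply]
  · rw [h.1 i j hh, g.1 i j hh]; rfl
  · have := h.2.1 i j a b c; have := g.2.1 i j a b c; omega
  · have := h.2.2.1 i j a b c; have := g.2.2.1 i j a b c; omega
  · have := h.2.2.2 i j a b c; have := g.2.2.2 i j a b c; omega

theorem IsMT.sup {n : ℕ} {τ σ : ℕ → ℕ → ℕ} (h : IsMT n τ) (g : IsMT n σ) : IsMT n (τ ⊔ σ) := by
  refine ⟨fun i j hh => ?_, fun i j a b c => ?_, fun i j a b c => ?_, fun i j a b c => ?_⟩ <;>
    simp only [Pi.sup_apply]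
  · rw [h.1 i j hh, g.1 i j hh]; rfl
  · have := h.2.1 i j a b c; have := g.2.1 i j a b c; omega
  · have := h.2.2.1 i j a b c; have := g.2.2.1 i j a b c; omega
  · have := h.2.2.2 i j a b c; have := g.2.2.2 i j a b c; omega

theorem mt_fkg (n : ℕ) (P Q : ℕ → Prop) :
    mtA n P * mtA n Q ≤ mtA n (fun i => P i ∨ Q i) * MTcount n := by
  classical
  have key := Finset.le_card_infs_mul_card_sups (mtS_finite n P).toFinset (mtS_finite n Q).toFinset
  rw [← Set.ncard_eq_toFinset_card _ (mtS_finite n P),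
    ← Set.ncard_eq_toFinset_card _ (mtS_finite n Q)] at key
  refine key.trans (Nat.mul_le_mul ?_ ?_)
  · rw [mtA, Set.ncard_eq_toFinset_card _ (mtS_finite n _)]
    apply Finset.card_le_card
    intro x hx
    obtain ⟨τ, hτ, σ, hσ, rfl⟩ := Finset.mem_infs.1 hx
    simp only [Set.Finite.mem_toFinset] at hτ hσ ⊢
    refine ⟨hτ.1.inf hσ.1, fun i hi => ?_⟩
    simp only [Pi.inf_apply]
    rcases hi with hi | hi
    · exact inf_le_left.trans (hτ.2 i hi)
    · exact inf_le_right.trans (hσ.2 i hi)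
  · rw [MTcount, Set.ncard_eq_toFinset_card _ (mt_finite n)]
    apply Finset.card_le_card
    intro x hx
    obtain ⟨τ, hτ, σ, hσ, rfl⟩ := Finset.mem_sups.1 hx
    simp only [Set.Finite.mem_toFinset] at hτ hσ ⊢
    exact hτ.1.sup hσ.1

theorem tmin_isMT (n : ℕ) : IsMT n (tmin n) := by
  refine ⟨fun i j hh => ?_, fun i j a b c => ?_, fun i j a b c => ?_, fun i j a b c => ?_⟩ <;>
    simp only [tmin]
  · rw [if_neg hh]
  · rw [if_pos ⟨a, b, c⟩]; omega
  · rw [if_pos ⟨a, by omega, c⟩, if_pos (by omega)]; omega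
  · rw [if_pos ⟨a, by omega, c⟩, if_pos (by omega), if_pos (by omega)]; omega

theorem MTcount_pos (n : ℕ) : 0 < MTcount n :=
  (Set.ncard_pos (mt_finite n)).2 ⟨_, tmin_isMT n⟩

/-- Restriction to the first `k` rows. -/
def topPart (k : ℕ) (τ : ℕ → ℕ → ℕ) : ℕ → ℕ → ℕ := fun i j => if i ≤ k then τ i j else 0

def botPart (k : ℕ) (τ : ℕ → ℕ → ℕ) : ℕ → ℕ → ℕ :=
  fun i j => if 1 ≤ j ∧ j ≤ i then τ (k + i) (k + j) - k else 0

theorem IsMT.topPart {n : ℕ} {τ : ℕ → ℕ → ℕ} (h : IsMT n τ) (k : ℕ) (hkn : k ≤ n)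
    (hk : τ k k ≤ k) : IsMT k (topPart k τ) := by
  have hcol : ∀ d i j, 1 ≤ j → j ≤ i → i + d = k → τ i j ≤ k := by
    intro d
    induction d with
    | zero =>
      intro i j h1 h2 h3
      obtain rfl : i = k := by omega
      rw [h.dist_row i hkn hk j h1 h2]; exact h2
    | succ d ih =>
      intro i j h1 h2 h3
      have := (h.2.2.2 (i+1) j h1 (by omega) (by omega)).2
      have := ih (i+1) (j+1) (by omega) (by omega) (by omega)
      simp only [Nat.add_sub_cancel] at *
      omega
  refine ⟨fun i j hh => ?_, fun i j a b c => ?_, fun i j a b c => ?_, fun i j a b c => ?_⟩ <;>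
    simp only [_root_.topPart]
  · split_ifs with hi
    · exact h.1 i j (by omega)
    · rfl
  · rw [if_pos c]
    exact ⟨(h.2.1 i j a b (by omega)).1, hcol (k - i) i j a b (by omega)⟩
  · rw [if_pos c, if_pos c]; exact h.2.2.1 i j a b (by omega)
  · rw [if_pos c, if_pos c, if_pos (by omega)]; exact h.2.2.2 i j a b (by omega)

theorem IsMT.botPart {n : ℕ} {τ : ℕ → ℕ → ℕ} (h : IsMT n τ) (k : ℕ) (hkn : k ≤ n)
    (hk : τ k k ≤ k) : IsMT (n - k) (botPart k τ) := by
  have hlow : ∀ i j, 1 ≤ j → j ≤ i → i ≤ n - k → k + 1 ≤ τ (k + i) (k + j) := by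
    intro i j a b c
    have := h.le_entry (k+i) (k+j) (by omega) (by omega) (by omega)
    omega
  refine ⟨fun i j hh => ?_, fun i j a b c => ?_, fun i j a b c => ?_, fun i j a b c => ?_⟩ <;>
    simp only [_root_.botPart]
  · split_ifs with hi
    · rw [h.1 (k+i) (k+j) (by omega)]; omega
    · rfl
  · rw [if_pos ⟨a, b⟩]
    have := hlow i j a b c
    have := h.2.1 (k+i) (k+j) (by omega) (by omega) (by omega)
    omega
  · rw [if_pos (by omega), if_pos (by omega)]
    have := hlow i j a (by omega) c
    have := h.2.2.1 (k+i) (k+j) (by omega) (by omega) (by omega)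
    rw [← add_assoc]
    omega
  · rw [if_pos (by omega), if_pos (by omega), if_pos (by omega)]
    have := h.2.2.2 (k+i) (k+j) (by omega) (by omega) (by omega)
    have e : k + i - 1 = k + (i - 1) := by omega
    rw [e] at this
    rw [← add_assoc]
    omega

theorem mtA_split_le (n k : ℕ) (P : ℕ → Prop) (hkn : k ≤ n) :
    mtA n (fun i => (P i ∧ i ≤ k) ∨ i = k) ≤ mtA k P * MTcount (n - k) := by
  rw [mtA, mtA, MTcount, ← Set.ncard_prod]
  refine Set.ncard_le_ncard_of_injOn (fun τ => (topPart k τ, botPart k τ)) ?_ ?_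
    ((mtS_finite _ _).prod (mt_finite _))
  · rintro τ ⟨h, hP⟩
    have hk := hP k (Or.inr rfl)
    refine ⟨⟨h.topPart k hkn hk, fun i hi => ?_⟩, h.botPart k hkn hk⟩
    simp only [topPart]
    split_ifs with hik
    · exact hP i (Or.inl ⟨hi, hik⟩)
    · omega
  · rintro τ ⟨h, hP⟩ σ ⟨g, gP⟩ e
    have hk := hP k (Or.inr rfl)
    have gk := gP k (Or.inr rfl)
    simp only [Prod.mk.injEq] at e
    funext i j
    by_cases hij : 1 ≤ j ∧ j ≤ i ∧ i ≤ n
    · obtain ⟨a, b, c⟩ := hij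
      by_cases hik : i ≤ k
      · have := congrFun (congrFun e.1 i) j
        simpa [topPart, hik] using this
      · obtain ⟨d, rfl⟩ : ∃ d, i = k + d := ⟨i - k, by omega⟩
        by_cases hjk : j ≤ k
        · rw [h.dist_below k hk d j a hjk c, g.dist_below k gk d j a hjk c]
        · obtain ⟨l, rfl⟩ : ∃ d, j = k + d := ⟨j - k, by omega⟩
          have := congrFun (congrFun e.2 d) l
          simp only [botPart] at this
          rw [if_pos (by omega), if_pos (by omega)] at this
          have := h.le_entry _ _ a b c
          have := g.le_entry _ _ a b c
          omega
    · rw [h.1 i j hij, g.1 i j hij]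

def glue (n k : ℕ) (σ ρ : ℕ → ℕ → ℕ) : ℕ → ℕ → ℕ := fun i j =>
  if i ≤ k then σ i j else if 1 ≤ j ∧ j ≤ i ∧ i ≤ n then
    (if j ≤ k then j else k + ρ (i - k) (j - k)) else 0

theorem glue_top {n k i j : ℕ} {σ ρ : ℕ → ℕ → ℕ} (h : i ≤ k) : glue n k σ ρ i j = σ i j := by
  simp [glue, h]

theorem glue_left {n k i j : ℕ} {σ ρ : ℕ → ℕ → ℕ} (h : k < i) (hi : i ≤ n) (hj : 1 ≤ j)
    (hk : j ≤ k) : glue n k σ ρ i j = j := by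
  have h1 : ¬ i ≤ k := by omega
  have h2 : 1 ≤ j ∧ j ≤ i ∧ i ≤ n := by omega
  simp [glue, h1, h2, hk]

theorem glue_right {n k i j : ℕ} {σ ρ : ℕ → ℕ → ℕ} (hi : i ≤ n) (hj : k < j)
    (hk : j ≤ i) : glue n k σ ρ i j = k + ρ (i - k) (j - k) := by
  have h1 : ¬ i ≤ k := by omega
  have h2 : 1 ≤ j ∧ j ≤ i ∧ i ≤ n := by omega
  have h3 : ¬ j ≤ k := by omega
  simp [glue, h1, h2, h3]

theorem glue_isMT {n k : ℕ} (hkn : k ≤ n) {σ ρ : ℕ → ℕ → ℕ} (h : IsMT k σ) (g : IsMT (n - k) ρ) :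
    IsMT n (glue n k σ ρ) := by
  refine ⟨fun i j hh => ?_, fun i j a b c => ?_, fun i j a b c => ?_, fun i j a b c => ?_⟩
  · simp only [glue]
    split_ifs with h1
    · exact h.1 i j (by omega)
    · rfl
  · by_cases h1 : i ≤ k
    · rw [glue_top h1]
      have := h.2.1 i j a b h1; omega
    · by_cases h2 : j ≤ k
      · rw [glue_left (by omega) c a h2]; omega
      · rw [glue_right c (by omega) b]
        have := g.2.1 (i - k) (j - k) (by omega) (by omega) (by omega); omega
  · by_cases h1 : i ≤ k
    · rw [glue_top h1, glue_top h1]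
      exact h.2.2.1 i j a b h1
    · by_cases h2 : j ≤ k
      · rw [glue_left (by omega) c a h2]
        by_cases h3 : j + 1 ≤ k
        · rw [glue_left (by omega) c (by omega) h3]; omega
        · rw [glue_right c (by omega) (by omega)]
          have := g.2.1 (i - k) (j + 1 - k) (by omega) (by omega) (by omega); omega
      · rw [glue_right c (by omega) (by omega), glue_right c (by omega) (by omega)]
        have := g.2.2.1 (i - k) (j - k) (by omega) (by omega) (by omega)
        have e : j + 1 - k = j - k + 1 := by omega
        rw [e]; omega
  · by_cases h1 : i ≤ k
    · rw [glue_top h1, glue_top h1, glue_top (by omega)]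
      exact h.2.2.2 i j a b h1
    · by_cases h4 : i - 1 ≤ k
      · obtain rfl : i = k + 1 := by omega
        have e : k + 1 - 1 = k := by omega
        rw [glue_top h4, e, h.last_row j a (by omega), glue_left (by omega) c a (by omega)]
        by_cases h3 : j + 1 ≤ k
        · rw [glue_left (by omega) c (by omega) h3]; omega
        · rw [glue_right c (by omega) (by omega)]; omega
      · by_cases h2 : j ≤ k
        · rw [glue_left (by omega) c a h2, glue_left (by omega) (by omega) a h2]
          by_cases h3 : j + 1 ≤ k
          · rw [glue_left (by omega) c (by omega) h3]; omega
          · rw [glue_right c (by omega) (by omega)]; omega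
        · rw [glue_right c (by omega) (by omega), glue_right (by omega) (by omega) (by omega),
            glue_right c (by omega) (by omega)]
          have := g.2.2.2 (i - k) (j - k) (by omega) (by omega) (by omega)
          have e : j + 1 - k = j - k + 1 := by omega
          have e' : i - 1 - k = i - k - 1 := by omega
          rw [e, e']; omega

theorem mtA_split_ge (n k : ℕ) (P : ℕ → Prop) (hkn : k ≤ n) :
    mtA k P * MTcount (n - k) ≤ mtA n (fun i => (P i ∧ i ≤ k) ∨ i = k) := by
  rw [mtA, mtA, MTcount, ← Set.ncard_prod]
  refine Set.ncard_le_ncard_of_injOn (fun p => glue n k p.1 p.2) ?_ ?_ (mtS_finite _ _)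
  · rintro ⟨σ, ρ⟩ ⟨⟨h, hP⟩, g⟩
    simp only [Set.mem_ofPred_eq] at h g hP
    refine ⟨glue_isMT hkn h g, fun i hi => ?_⟩
    have : i ≤ k := by omega
    simp only [glue, if_pos this]
    rcases hi with hi | rfl
    · exact hP i hi.1
    · by_cases h0 : 1 ≤ i
      · exact (h.last_row i h0 le_rfl).le
      · rw [h.1 i i (by omega)]; omega
  · rintro ⟨σ, ρ⟩ ⟨⟨h, hP⟩, g⟩ ⟨σ', ρ'⟩ ⟨⟨h', hP'⟩, g'⟩ e
    simp only [Set.mem_ofPred_eq] at h g h' g' e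
    simp only [Prod.mk.injEq]
    constructor
    · funext i j
      by_cases hik : i ≤ k
      · have := congrFun (congrFun e i) j
        simpa [glue, hik] using this
      · rw [h.1 i j (by omega), h'.1 i j (by omega)]
    · funext i j
      by_cases hij : 1 ≤ j ∧ j ≤ i ∧ i ≤ n - k
      · have := congrFun (congrFun e (k + i)) (k + j)
        rw [glue_right (by omega) (by omega) (by omega),
          glue_right (by omega) (by omega) (by omega)] at this
        simpa using this
      · rw [g.1 i j hij, g'.1 i j hij]

theorem mtA_congr {n : ℕ} {P Q : ℕ → Prop} (h : ∀ i, P i ↔ Q i) : mtA n P = mtA n Q := by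
  rw [show P = Q from funext fun i => propext (h i)]

theorem mtA_single (n k : ℕ) (hkn : k ≤ n) :
    mtA n (fun i => i = k) = MTcount k * MTcount (n - k) := by
  have h1 := mtA_split_le n k (fun _ => False) hkn
  have h2 := mtA_split_ge n k (fun _ => False) hkn
  rw [mtA_false] at h1 h2
  simp only [false_and, false_or] at h1 h2
  omega

/-- L1 -/
theorem mtA_L1 (n k : ℕ) (P : ℕ → Prop) (hkn : k ≤ n) (hP : ∀ i, P i → i ≤ k) :
    mtA n P * MTcount k ≤ mtA k P * MTcount n := by
  have h1 := mt_fkg n P (fun i => i = k)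
  rw [mtA_single n k hkn] at h1
  have h2 := mtA_split_le n k P hkn
  rw [mtA_congr (Q := fun i => P i ∨ i = k)
    (fun i => ⟨fun h => h.imp_left And.left, fun h => h.imp_left fun h => ⟨h, hP i h⟩⟩)] at h2
  have h3 := h1.trans (Nat.mul_le_mul_right _ h2)
  have := MTcount_pos (n - k)
  refine le_of_mul_le_mul_right (a := MTcount (n - k)) ?_ this
  nlinarith

/-- log-convexity -/
theorem MT_logconvex (i j n : ℕ) (hij : i ≤ j) (hjn : j ≤ n) :
    MTcount (n - i) * MTcount j ≤ MTcount (j - i) * MTcount n := by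
  have h := mtA_L1 n j (fun l => l = i) hjn (fun l hl => by omega)
  rw [mtA_single n i (by omega), mtA_single j i hij] at h
  refine le_of_mul_le_mul_left (a := MTcount i) ?_ (MTcount_pos i)
  nlinarith

theorem MTcount_one : MTcount 1 = 1 := by
  rw [MTcount, Set.ncard_eq_one]
  refine ⟨tmin 1, Set.eq_singleton_iff_unique_mem.2 ⟨tmin_isMT 1, fun τ hτ => ?_⟩⟩
  have hτ : IsMT 1 τ := hτ
  funext i j
  by_cases h : 1 ≤ j ∧ j ≤ i ∧ i ≤ 1
  · obtain rfl : i = 1 := by omega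
    rw [hτ.last_row j h.1 h.2.1, tmin, if_pos h]
  · rw [hτ.1 i j h, tmin, if_neg h]

/-- L2 -/
theorem mtA_L2 (n s : ℕ) (P : ℕ → Prop) (hsn : s ≤ n) (hP : ∀ i, P i → i ≤ s) (hs : P s) :
    mtA n P ≤ mtA (s + 1) P * MTcount (n - s) := by
  have e : ∀ i, ((P i ∧ i ≤ s) ∨ i = s) ↔ P i := fun i =>
    ⟨fun h => h.elim And.left (fun h => h ▸ hs), fun h => Or.inl ⟨h, hP i h⟩⟩
  have h1 := mtA_split_le n s P hsn
  have h2 := mtA_split_ge (s+1) s P (by omega)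
  rw [mtA_congr e] at h1 h2
  rw [Nat.add_sub_cancel_left, MTcount_one, mul_one] at h2
  exact h1.trans (Nat.mul_le_mul_right _ h2)

/-- L3 -/
theorem mtA_L3 (n s : ℕ) (P Q : ℕ → Prop) (hsn : s + 1 ≤ n) (hQ : ∀ i, Q i → P i)
    (hs : ∀ i, s < i → i < n → P i) :
    mtA n P ≤ mtA (s + 1) Q := by
  refine Set.ncard_le_ncard_of_injOn (topPart (s+1)) ?_ ?_ (mtS_finite _ _)
  · rintro τ ⟨h, hP⟩
    have hk : τ (s+1) (s+1) ≤ s + 1 := by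
      by_cases hn : s + 1 < n
      · exact hP _ (hs _ (by omega) hn)
      · obtain rfl : n = s + 1 := by omega
        exact (h.last_row _ (by omega) le_rfl).le
    refine ⟨h.topPart (s+1) hsn hk, fun i hi => ?_⟩
    simp only [topPart]
    split_ifs with hik
    · exact hP i (hQ i hi)
    · omega
  · have hrow : ∀ τ ∈ mtS n P, ∀ i j, s + 1 ≤ i → 1 ≤ j → j ≤ i → i ≤ n → τ i j = j := by
      rintro τ ⟨h, hP⟩ i j h0 a b c
      by_cases hn : i < n
      · exact h.dist_row i c (hP i (hs i (by omega) hn)) j a b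
      · obtain rfl : i = n := by omega
        exact h.last_row j a b
    intro τ hτ σ hσ e
    funext i j
    by_cases hij : 1 ≤ j ∧ j ≤ i ∧ i ≤ n
    · obtain ⟨a, b, c⟩ := hij
      by_cases hi : i ≤ s + 1
      · have := congrFun (congrFun e i) j
        simpa [topPart, hi] using this
      · rw [hrow τ hτ i j (by omega) a b c, hrow σ hσ i j (by omega) a b c]
    · rw [hτ.1.1 i j hij, hσ.1.1 i j hij]

def insMT (n k : ℕ) (τ : ℕ → ℕ → ℕ) : ℕ → ℕ → ℕ := fun i j =>
  if 1 ≤ j ∧ j ≤ i ∧ i ≤ n + 1 then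
    (if i = n + 1 then j else if τ i j ≤ k then τ i j else τ i j + 1) else 0

theorem insMT_last {n k j : ℕ} {τ : ℕ → ℕ → ℕ} (h1 : 1 ≤ j) (h2 : j ≤ n + 1) :
    insMT n k τ (n + 1) j = j := by
  simp [insMT, h1, h2]

theorem insMT_body {n k i j : ℕ} {τ : ℕ → ℕ → ℕ} (h1 : 1 ≤ j) (h2 : j ≤ i) (h3 : i ≤ n) :
    insMT n k τ i j = if τ i j ≤ k then τ i j else τ i j + 1 := by
  have h : 1 ≤ j ∧ j ≤ i ∧ i ≤ n + 1 := by omega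
  have h' : ¬ i = n + 1 := by omega
  simp [insMT, h, h']

theorem insMT_isMT {n k : ℕ} {τ : ℕ → ℕ → ℕ} (h : IsMT n τ) : IsMT (n + 1) (insMT n k τ) := by
  refine ⟨fun i j hh => ?_, fun i j a b c => ?_, fun i j a b c => ?_, fun i j a b c => ?_⟩
  · rw [insMT, if_neg hh]
  · by_cases h1 : i = n + 1
    · subst h1
      rw [insMT_last a b]; omega
    · have := h.2.1 i j a b (by omega)
      rw [insMT_body a b (by omega)]; split_ifs <;> omega
  · by_cases h1 : i = n + 1
    · subst h1
      rw [insMT_last a (by omega), insMT_last (by omega) (by omega)]; omega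
    · have := h.2.2.1 i j a b (by omega)
      rw [insMT_body a (by omega) (by omega), insMT_body (by omega) (by omega) (by omega)]
      split_ifs <;> omega
  · by_cases h1 : i = n + 1
    · subst h1
      rw [insMT_last a (by omega), insMT_last (by omega) (by omega), Nat.add_sub_cancel,
        insMT_body a (by omega) le_rfl, h.last_row j a (by omega)]
      split_ifs <;> omega
    · have := h.2.2.2 i j a b (by omega)
      rw [insMT_body a (by omega) (by omega), insMT_body (by omega) (by omega) (by omega),
        insMT_body (by omega) (by omega) (by omega)]
      split_ifs <;> omega

theorem MTcount_succ (n : ℕ) : (n + 1) * MTcount n ≤ MTcount (n + 1) := by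
  have e : (n + 1) * MTcount n = ((Set.Iic n) ×ˢ {τ | IsMT n τ}).ncard := by
    rw [Set.ncard_prod, MTcount]
    congr 1
    rw [← Finset.coe_Iic, Set.ncard_coe_finset]; simp
  rw [e, MTcount]
  refine Set.ncard_le_ncard_of_injOn (fun p => insMT n p.1 p.2) ?_ ?_ (mt_finite _)
  · rintro ⟨k, τ⟩ ⟨-, h⟩
    exact insMT_isMT h
  · rintro ⟨k, τ⟩ ⟨hk, h⟩ ⟨k', τ'⟩ ⟨hk', h'⟩ e
    simp only [Set.mem_ofPred_eq, Set.mem_Iic] at hk hk' h h' e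
    have hval : ∀ i j, 1 ≤ j → j ≤ i → i ≤ n →
        (if τ i j ≤ k then τ i j else τ i j + 1) = (if τ' i j ≤ k' then τ' i j else τ' i j + 1) := by
      intro i j a b c
      have := congrFun (congrFun e i) j
      rwa [insMT_body a b c, insMT_body a b c] at this
    have hkk : k = k' := by
      by_contra hne
      have h1 := hval n (min k k' + 1) (by omega) (by omega) le_rfl
      rw [h.last_row _ (by omega) (by omega), h'.last_row _ (by omega) (by omega)] at h1
      split_ifs at h1 <;> omega
    subst hkk
    simp only [Prod.mk.injEq, true_and]
    funext i j
    by_cases hij : 1 ≤ j ∧ j ≤ i ∧ i ≤ n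
    · have := hval i j hij.1 hij.2.1 hij.2.2
      split_ifs at this <;> omega
    · rw [h.1 i j hij, h'.1 i j hij]

theorem MTcount_ge (n : ℕ) : n ≤ MTcount n := by
  cases n with
  | zero => omega
  | succ n => have := MTcount_succ n; have := MTcount_pos n; nlinarith

/-- The rows assigned to letter `m` by the word `f`. -/
def wP {N r : ℕ} (f : Fin N → Fin r) (m : Fin r) (i : ℕ) : Prop :=
  ∃ k : Fin N, i = k + 1 ∧ f k = m

/-- Weight of a word. -/
noncomputable def wg (r N : ℕ) (f : Fin N → Fin r) : ℝ :=
  (MTcount (N + 1) : ℝ) * ∏ m, ((mtA (N + 1) (wP f m) : ℝ) / (MTcount (N + 1) : ℝ))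

noncomputable def tt (r N : ℕ) : ℝ := ∑ f : Fin N → Fin r, wg r N f

noncomputable def bet (N s : ℕ) : ℝ :=
  (MTcount (s + 1) : ℝ) * MTcount (N + 1 - s) / MTcount (N + 1)

theorem MTpos (n : ℕ) : (0 : ℝ) < MTcount n := by exact_mod_cast MTcount_pos n

theorem bet_nonneg (N s : ℕ) : 0 ≤ bet N s := by unfold bet; positivity

theorem wg_nonneg (r N : ℕ) (f : Fin N → Fin r) : 0 ≤ wg r N f := by
  unfold wg; positivity

theorem tt_nonneg (r N : ℕ) : 0 ≤ tt r N := Finset.sum_nonneg fun f _ => wg_nonneg r N f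

theorem wg_const (r N : ℕ) (f : Fin N → Fin r) (m : Fin r) (hf : ∀ k, f k = m) :
    wg r N f ≤ 1 := by
  have hA := MTpos (N + 1)
  have h1 : ∏ k, ((mtA (N + 1) (wP f k) : ℝ) / (MTcount (N + 1) : ℝ)) ≤
      ∏ k, (if k = m then ((MTcount (N + 1) : ℝ))⁻¹ else 1) := by
    apply Finset.prod_le_prod
    · intros; positivity
    · intro k _
      split_ifs with h
      · subst h
        rw [div_eq_mul_inv]
        have : mtA (N + 1) (wP f k) ≤ 1 := by
          have := mtA_L3 (N + 1) 0 (wP f k) (fun _ => False) (by omega) (fun _ h => h.elim)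
            (fun i h1 h2 => ⟨⟨i - 1, by omega⟩, by simp; omega, hf _⟩)
          rwa [mtA_false, zero_add, MTcount_one] at this
        have : (mtA (N + 1) (wP f k) : ℝ) ≤ 1 := by exact_mod_cast this
        have := inv_pos.2 hA
        nlinarith
      · rw [div_le_one hA]
        exact_mod_cast mtA_le _ _
  rw [Finset.prod_ite_eq' Finset.univ m] at h1
  simp only [Finset.mem_univ, if_true] at h1
  unfold wg
  calc _ ≤ (MTcount (N + 1) : ℝ) * (MTcount (N + 1) : ℝ)⁻¹ := by gcongr
    _ = 1 := mul_inv_cancel₀ hA.ne'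

theorem wg_ext (r N s : ℕ) (hs : 1 ≤ s) (hsN : s < N) (f : Fin N → Fin r) (f' : Fin s → Fin r)
    (m : Fin r) (hf : ∀ k : Fin N, f k = if h : (k : ℕ) < s then f' ⟨k, h⟩ else m)
    (hne : f' ⟨s - 1, by omega⟩ ≠ m) : wg r N f ≤ wg r s f' * bet N s := by
  have hA := MTpos (N + 1)
  have hB := MTpos (s + 1)
  set m' := f' ⟨s - 1, by omega⟩ with hm'
  set α : ℝ := MTcount (s + 1) / MTcount (N + 1) with hα
  have hP1 : ∀ k i, wP f' k i → wP f k i := by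
    rintro k i ⟨l, rfl, h2⟩
    refine ⟨⟨l, by omega⟩, rfl, ?_⟩
    rw [hf]; simpa using h2
  have hP2 : ∀ k i, k ≠ m → (wP f k i ↔ wP f' k i) := by
    intro k i hk
    refine ⟨?_, hP1 k i⟩
    rintro ⟨l, rfl, h2⟩
    rw [hf] at h2
    split_ifs at h2 with h3
    · exact ⟨⟨l, h3⟩, rfl, h2⟩
    · exact absurd h2.symm hk
  have hP3 : ∀ k i, wP f' k i → i ≤ s := by
    rintro k i ⟨l, rfl, h2⟩; omega
  have h1 : ∏ k, ((mtA (N + 1) (wP f k) : ℝ) / (MTcount (N + 1) : ℝ)) ≤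
      ∏ k, (((mtA (s + 1) (wP f' k) : ℝ) / (MTcount (s + 1) : ℝ)) *
        ((if k = m then α else 1) * (if k = m' then bet N s else 1))) := by
    apply Finset.prod_le_prod
    · intros; positivity
    · intro k _
      by_cases h : k = m
      · subst h
        rw [if_pos rfl, if_neg (Ne.symm hne), mul_one]
        have := mtA_L3 (N + 1) s (wP f k) (wP f' k) (by omega) (hP1 k)
            (fun i h1 h2 => ⟨⟨i - 1, by omega⟩, by simp; omega, by
              rw [hf, dif_neg]; simp; omega⟩)
        have : (mtA (N + 1) (wP f k) : ℝ) ≤ mtA (s + 1) (wP f' k) := by exact_mod_cast this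
        rw [hα, div_mul_div_cancel₀ hB.ne']
        gcongr
      · rw [if_neg h, one_mul, mtA_congr (hP2 k · h)]
        by_cases h2 : k = m'
        · rw [if_pos h2]
          have := mtA_L2 (N + 1) s (wP f' k) (by omega) (hP3 k)
            ⟨⟨s - 1, by omega⟩, by simp; omega, h2.symm⟩
          have : (mtA (N + 1) (wP f' k) : ℝ) ≤ mtA (s + 1) (wP f' k) * MTcount (N + 1 - s) := by
            exact_mod_cast this
          have e : (mtA (s + 1) (wP f' k) : ℝ) / (MTcount (s + 1) : ℝ) * bet N s =
            (mtA (s + 1) (wP f' k) * MTcount (N + 1 - s)) / MTcount (N + 1) := by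
            unfold bet; field_simp
          rw [e]
          gcongr
        · rw [if_neg h2, mul_one, div_le_div_iff₀ hA hB]
          exact_mod_cast mtA_L1 (N + 1) (s + 1) (wP f' k) (by omega)
            (fun i hi => (hP3 k i hi).trans (by omega))
  rw [Finset.prod_mul_distrib, Finset.prod_mul_distrib, Finset.prod_ite_eq' Finset.univ m,
    Finset.prod_ite_eq' Finset.univ m'] at h1
  simp only [Finset.mem_univ, if_true] at h1
  unfold wg
  refine (mul_le_mul_of_nonneg_left h1 hA.le).trans (le_of_eq ?_)
  rw [hα]
  field_simp

theorem tt_zero (r : ℕ) : tt r 0 = 1 := by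
  have h : ∀ f : Fin 0 → Fin r, wg r 0 f = 1 := by
    intro f
    have : ∀ m, mtA 1 (wP f m) = 1 := by
      intro m
      rw [mtA_congr (Q := fun _ => False) (fun i => ⟨fun ⟨k, _⟩ => k.elim0, fun h => h.elim⟩),
        mtA_false, MTcount_one]
    simp [wg, this, MTcount_one]
  simp [tt, h]

theorem bet_zero (N : ℕ) : bet N 0 = 1 := by
  have hA := MTpos (N + 1)
  simp [bet, MTcount_one, hA.ne']

/-- Extension of a word by a constant word. -/
def extw {r : ℕ} (N s : ℕ) (f' : Fin s → Fin r) (m : Fin r) : Fin N → Fin r :=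
  fun k => if h : (k : ℕ) < s then f' ⟨k, h⟩ else m

theorem wg_bet_zero (r N s : ℕ) (h : s = 0) (f : Fin s → Fin r) : wg r s f * bet N s = 1 := by
  subst h
  have := tt_zero r
  rw [bet_zero, mul_one]
  rw [tt, Fintype.sum_unique] at this
  rw [← this]
  congr 1
  exact Subsingleton.elim _ _

theorem word_cases (r N : ℕ) (f : Fin (N + 1) → Fin r) :
    ∃ s, s < N + 1 ∧ ∃ f' : Fin s → Fin r, ∃ m, f = extw (N + 1) s f' m ∧
      wg r (N + 1) f ≤ wg r s f' * bet (N + 1) s := by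
  classical
  set m := f (Fin.last N) with hm
  have hex : ∃ s, ∀ k : Fin (N + 1), s ≤ (k : ℕ) → f k = m :=
    ⟨N, fun k hk => by rw [hm]; congr 1; apply Fin.ext; simp; omega⟩
  set s := Nat.find hex with hs
  have hspec := Nat.find_spec hex
  rw [← hs] at hspec
  have hsN : s ≤ N := Nat.find_min' hex
    (fun k hk => by rw [hm]; congr 1; apply Fin.ext; simp; omega)
  have hext : f = extw (N + 1) s (fun k => f ⟨k, by omega⟩) m := by
    funext k
    simp only [extw]
    split_ifs with h
    · rfl
    · exact hspec k (by omega)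
  refine ⟨s, by omega, fun k => f ⟨k, by omega⟩, m, hext, ?_⟩
  by_cases h0 : s = 0
  · rw [wg_bet_zero r (N + 1) s h0]
    exact wg_const r (N + 1) f m (fun k => hspec k (by omega))
  · refine wg_ext r (N + 1) s (by omega) (by omega) f _ m (fun k => congrFun hext k) ?_
    intro heq
    refine Nat.find_min hex (m := s - 1) (by omega) ?_
    intro k hk
    by_cases hks : s ≤ (k : ℕ)
    · exact hspec k hks
    · rw [← heq]
      congr 1
      apply Fin.ext
      simp
      omega

theorem tt_rec (r N : ℕ) :
    tt r (N + 1) ≤ r * ∑ s ∈ Finset.range (N + 1), tt r s * bet (N + 1) s := by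
  classical
  have h1 : ∀ f : Fin (N + 1) → Fin r, wg r (N + 1) f ≤
      ∑ s ∈ Finset.range (N + 1), ∑ f' : Fin s → Fin r, ∑ m : Fin r,
        if f = extw (N + 1) s f' m then wg r s f' * bet (N + 1) s else 0 := by
    intro f
    have nn : ∀ s (f' : Fin s → Fin r) (m : Fin r),
      0 ≤ if f = extw (N + 1) s f' m then wg r s f' * bet (N + 1) s else 0 := by
      intro s f' m
      split_ifs
      · exact mul_nonneg (wg_nonneg _ _ _) (bet_nonneg _ _)
      · exact le_rfl
    obtain ⟨s, hs, f', m, e, h⟩ := word_cases r N f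
    refine le_trans ?_ (Finset.single_le_sum (fun s _ => Finset.sum_nonneg fun f' _ =>
      Finset.sum_nonneg fun m _ => nn s f' m) (Finset.mem_range.2 hs))
    refine le_trans ?_ (Finset.single_le_sum (fun f' _ =>
      Finset.sum_nonneg fun m _ => nn s f' m) (Finset.mem_univ f'))
    refine le_trans ?_ (Finset.single_le_sum (fun m _ => nn s f' m) (Finset.mem_univ m))
    rw [if_pos e]
    exact h
  unfold tt
  refine (Finset.sum_le_sum fun f _ => h1 f).trans (le_of_eq ?_)
  rw [Finset.sum_comm, Finset.mul_sum]
  refine Finset.sum_congr rfl fun s _ => ?_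
  rw [Finset.sum_comm, Finset.sum_mul, Finset.mul_sum]
  refine Finset.sum_congr rfl fun f' _ => ?_
  rw [Finset.sum_comm]
  simp

theorem bet_le (N s : ℕ) (h1 : 1 ≤ s) (h2 : s ≤ N) :
    bet (N + 1) s ≤ (if s = 1 ∨ s = N then (MTcount 2 : ℝ) / (N + 2) else
      MTcount 3 / ((N + 1) * (N + 2))) := by
  have hA := MTpos (N + 2)
  have g1 : ((N : ℝ) + 2) * MTcount (N + 1) ≤ MTcount (N + 2) := by
    have := MTcount_succ (N + 1)
    exact_mod_cast this
  have g2 : ((N : ℝ) + 1) * MTcount N ≤ MTcount (N + 1) := by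
    exact_mod_cast MTcount_succ N
  unfold bet
  rw [show N + 1 + 1 = N + 2 from rfl]
  split_ifs with h
  · have e : (MTcount (s + 1) : ℝ) * MTcount (N + 2 - s) = MTcount 2 * MTcount (N + 1) := by
      rcases h with rfl | rfl
      · rfl
      · rw [show s + 2 - s = 2 by omega]; ring
    rw [e, div_le_div_iff₀ hA (by positivity)]
    have := MTpos 2
    nlinarith
  · have h4 := MT_logconvex (s - 2) (N + 2 - (N + 1 - s) - 0) N (by omega) (by omega)
    have e1 : N - (s - 2) = N + 2 - s := by omega
    have e2 : N + 2 - (N + 1 - s) - 0 = s + 1 := by omega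
    have e3 : s + 1 - (s - 2) = 3 := by omega
    rw [e1, e2, e3] at h4
    have h5 : (MTcount (N + 2 - s) : ℝ) * MTcount (s + 1) ≤ MTcount 3 * MTcount N := by
      exact_mod_cast h4
    rw [div_le_div_iff₀ hA (by positivity)]
    have := MTpos 3
    have g3 : ((N : ℝ) + 1) * (N + 2) * MTcount N ≤ MTcount (N + 2) := by nlinarith
    calc _ ≤ ((MTcount 3 : ℝ) * MTcount N) * ((N + 1) * (N + 2)) := by
          rw [mul_comm (MTcount (s + 1) : ℝ)]; gcongr
      _ = MTcount 3 * ((N + 1) * (N + 2) * MTcount N) := by ring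
      _ ≤ _ := by gcongr

theorem bet_sum (N : ℕ) : ∑ s ∈ Finset.Icc 1 N, bet (N + 1) s ≤
    (2 * MTcount 2 + MTcount 3 : ℝ) / (N + 2) := by
  have h2 := MTpos 2
  have h3 := MTpos 3
  have h : ∀ s ∈ Finset.Icc 1 N, bet (N + 1) s ≤
      (if s = 1 then (MTcount 2 : ℝ) / (N + 2) else 0) +
      (if s = N then (MTcount 2 : ℝ) / (N + 2) else 0) + MTcount 3 / ((N + 1) * (N + 2)) := by
    intro s hs
    rw [Finset.mem_Icc] at hs
    refine (bet_le N s hs.1 hs.2).trans ?_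
    have : 0 ≤ (MTcount 2 : ℝ) / (N + 2) := by positivity
    have : 0 ≤ (MTcount 3 : ℝ) / ((N + 1) * (N + 2)) := by positivity
    split_ifs <;> first | linarith | (exfalso; tauto)
  refine (Finset.sum_le_sum h).trans ?_
  rw [Finset.sum_add_distrib, Finset.sum_add_distrib, Finset.sum_ite_eq', Finset.sum_ite_eq',
    Finset.sum_const, Nat.card_Icc, nsmul_eq_mul]
  have a1 : (if 1 ∈ Finset.Icc 1 N then (MTcount 2 : ℝ) / (N + 2) else 0) ≤ MTcount 2 / (N + 2) := by
    split_ifs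
    · exact le_rfl
    · positivity
  have a2 : (if N ∈ Finset.Icc 1 N then (MTcount 2 : ℝ) / (N + 2) else 0) ≤ MTcount 2 / (N + 2) := by
    split_ifs
    · exact le_rfl
    · positivity
  have a3 : ((N + 1 - 1 : ℕ) : ℝ) * (MTcount 3 / ((N + 1) * (N + 2))) ≤ MTcount 3 / (N + 2) := by
    rw [Nat.add_sub_cancel, mul_div_assoc', div_le_div_iff₀ (by positivity) (by positivity)]
    have : (0 : ℝ) ≤ MTcount 3 * (N + 2) := by positivity
    nlinarith
  rw [add_div, two_mul, add_div]
  linarith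

theorem tt_bound (r : ℕ) : ∃ M : ℝ, 0 ≤ M ∧ ∀ N : ℕ, tt r (N + 1) ≤ r + M / (N + 2) := by
  set C : ℝ := 2 * MTcount 2 + MTcount 3 with hC
  have hC0 : 0 < C := by have := MTpos 2; have := MTpos 3; positivity
  have hrec : ∀ (N : ℕ) (M : ℝ), 0 ≤ M → (∀ s ≤ N, tt r s ≤ M) →
      tt r (N + 1) ≤ r + r * (M * (C / (N + 2))) := by
    intro N M hM h
    refine (tt_rec r N).trans ?_
    have e : ∑ s ∈ Finset.range (N + 1), tt r s * bet (N + 1) s =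
        1 + ∑ s ∈ Finset.Icc 1 N, tt r s * bet (N + 1) s := by
      rw [Finset.range_eq_Ico, Finset.sum_eq_sum_Ico_succ_bot (by omega), tt_zero, bet_zero,
        mul_one]
      rfl
    rw [e]
    have : ∑ s ∈ Finset.Icc 1 N, tt r s * bet (N + 1) s ≤ M * (C / (N + 2)) := by
      refine le_trans ?_ (mul_le_mul_of_nonneg_left (bet_sum N) hM)
      rw [Finset.mul_sum]
      refine Finset.sum_le_sum fun s hs => ?_
      exact mul_le_mul_of_nonneg_right (h s (Finset.mem_Icc.1 hs).2) (bet_nonneg _ _)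
    have hr : (0 : ℝ) ≤ r := by positivity
    nlinarith
  obtain ⟨N0, hN0⟩ := exists_nat_gt (2 * r * C)
  set M : ℝ := 2 * r + ∑ s ∈ Finset.range (N0 + 1), tt r s with hMdef
  have hsum : 0 ≤ ∑ s ∈ Finset.range (N0 + 1), tt r s := Finset.sum_nonneg fun s _ => tt_nonneg r s
  have hM : 0 ≤ M := by positivity
  have hb : ∀ s, tt r s ≤ M := by
    intro s
    induction s using Nat.strong_induction_on with
    | _ s ih =>
      by_cases hs : s ≤ N0
      · have := Finset.single_le_sum (f := tt r) (fun s _ => tt_nonneg r s)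
          (Finset.mem_range.2 (show s < N0 + 1 by omega))
        have : (0 : ℝ) ≤ 2 * r := by positivity
        linarith
      · obtain ⟨N, rfl⟩ : ∃ N, s = N + 1 := ⟨s - 1, by omega⟩
        have h1 := hrec N M hM (fun s hs => ih s (by omega))
        have h2 : (N0 : ℝ) ≤ N := by exact_mod_cast (by omega : N0 ≤ N)
        have h3 : r * (M * (C / (N + 2))) ≤ M / 2 := by
          rw [show r * (M * (C / (N + 2))) = (r * C * M) / ((N : ℝ) + 2) by ring,
            div_le_div_iff₀ (by positivity) (by norm_num)]
          nlinarith
        linarith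
  refine ⟨r * M * C, by positivity, fun N => ?_⟩
  refine (hrec N M hM fun s _ => hb s).trans (le_of_eq ?_)
  ring

/-- The set counted in the theorem. -/
def covT (r n : ℕ) : Set (Fin r → ℕ → ℕ → ℕ) :=
  {τs | (∀ m, IsMT n (τs m)) ∧ infTuple τs = tmin n}

theorem covT_finite (r n : ℕ) : (covT r n).Finite :=
  (Set.Finite.pi' (fun _ => mt_finite n)).subset (fun _ h => h.1)

theorem covT_upper (r N : ℕ) (hr : 1 ≤ r) :
    ((covT r (N + 1)).ncard : ℝ) ≤ (MTcount (N + 1) : ℝ) ^ (r - 1) * tt r N := by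
  classical
  have : Nonempty (Fin r) := ⟨⟨0, hr⟩⟩
  have hA := MTpos (N + 1)
  have h1 : (covT r (N + 1)).ncard ≤ ∑ f : Fin N → Fin r, ∏ m, mtA (N + 1) (wP f m) := by
    let S : (Fin N → Fin r) → Finset (Fin r → ℕ → ℕ → ℕ) := fun f =>
      Fintype.piFinset fun m => (mtS_finite (N + 1) (wP f m)).toFinset
    have h2 : (covT r (N + 1)).ncard ≤ (Finset.univ.biUnion S).card := by
      rw [← Set.ncard_coe_finset]
      refine Set.ncard_le_ncard ?_ (Finset.finite_toSet _)
      rintro τs ⟨hMT, hinf⟩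
      have hc : ∀ k : Fin N, ∃ m, τs m (k + 1) (k + 1) ≤ k + 1 := by
        intro k
        have e := congrFun (congrFun hinf (k + 1)) (k + 1)
        simp only [infTuple, tmin] at e
        rw [if_pos (by omega)] at e
        have := Nat.sInf_mem (Set.range_nonempty fun m => τs m (k + 1) (k + 1))
        obtain ⟨m, hm⟩ := this
        refine ⟨m, ?_⟩
        rw [iInf] at e
        have hm : τs m (k + 1) (k + 1) = _ := hm
        rw [e] at hm
        exact hm.le
      choose f hf using hc
      simp only [Finset.coe_biUnion, Set.mem_iUnion]
      refine ⟨f, by simp, ?_⟩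
      simp only [S, Finset.mem_coe, Fintype.mem_piFinset, Set.Finite.mem_toFinset]
      intro m
      refine ⟨hMT m, ?_⟩
      rintro i ⟨k, rfl, rfl⟩
      exact hf k
    refine h2.trans (Finset.card_biUnion_le.trans (Finset.sum_le_sum fun f _ => le_of_eq ?_))
    simp only [S, Fintype.card_piFinset]
    refine Finset.prod_congr rfl fun m _ => ?_
    rw [mtA, Set.ncard_eq_toFinset_card _ (mtS_finite _ _)]
  have h3 : ((covT r (N + 1)).ncard : ℝ) ≤
      ∑ f : Fin N → Fin r, ∏ m, (mtA (N + 1) (wP f m) : ℝ) := by exact_mod_cast h1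
  refine h3.trans (le_of_eq ?_)
  rw [tt, Finset.mul_sum]
  refine Finset.sum_congr rfl fun f _ => ?_
  rw [wg, Finset.prod_div_distrib, Finset.prod_const, Finset.card_univ, Fintype.card_fin,
    ← mul_assoc, ← pow_succ, Nat.sub_add_cancel hr, mul_div_cancel₀]
  positivity

theorem covT_lower (r n : ℕ) (hr : 1 ≤ r) :
    MTcount n ^ r ≤ (covT r n).ncard + (MTcount n - 1) ^ r := by
  classical
  have : Nonempty (Fin r) := ⟨⟨0, hr⟩⟩
  set F := (mt_finite n).toFinset with hF
  have hFc : F.card = MTcount n := by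
    rw [MTcount, Set.ncard_eq_toFinset_card _ (mt_finite n)]
  have hmem : tmin n ∈ F := by simpa [hF] using tmin_isMT n
  have h1 : (Fintype.piFinset fun _ : Fin r => F).card = MTcount n ^ r := by
    simp [hFc]
  have h2 : (Fintype.piFinset fun _ : Fin r => F.erase (tmin n)).card = (MTcount n - 1) ^ r := by
    simp [hFc, Finset.card_erase_of_mem hmem]
  rw [← h1, ← h2, Set.ncard_eq_toFinset_card _ (covT_finite r n)]
  refine le_trans (Finset.card_le_card ?_) (Finset.card_union_le _ _)
  intro τs hτs
  rw [Fintype.mem_piFinset] at hτs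
  have hMT : ∀ m, IsMT n (τs m) := fun m => by simpa [hF] using hτs m
  rw [Finset.mem_union, Set.Finite.mem_toFinset, Fintype.mem_piFinset]
  by_cases h : ∃ m, τs m = tmin n
  · left
    obtain ⟨m0, hm0⟩ := h
    refine ⟨hMT, ?_⟩
    funext i j
    apply le_antisymm
    · calc infTuple τs i j ≤ τs m0 i j := ciInf_le (OrderBot.bddBelow _) m0
        _ = _ := by rw [hm0]
    · refine le_ciInf fun m => ?_
      simp only [tmin]
      split_ifs with hij
      · exact (hMT m).le_entry i j hij.1 hij.2.1 hij.2.2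
      · omega
  · right
    intro m
    rw [Finset.mem_erase]
    exact ⟨fun h' => h ⟨m, h'⟩, hτs m⟩

theorem pow_diff (a : ℝ) (ha : 1 ≤ a) (r : ℕ) :
    ((r : ℝ) + 1) * (a - 1) ^ r ≤ a ^ (r + 1) - (a - 1) ^ (r + 1) := by
  induction r with
  | zero => simp
  | succ r ih =>
    have h1 : 0 ≤ (a - 1) ^ r := pow_nonneg (by linarith) r
    have h2 : (a - 1) ^ r ≤ a ^ r := pow_le_pow_left₀ (by linarith) (by linarith) r
    have h3 : (a - 1) ^ (r + 1) ≤ a ^ (r + 1) := pow_le_pow_left₀ (by linarith) (by linarith) _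
    push_cast
    rw [pow_succ a (r + 1), pow_succ (a - 1) (r + 1)]
    have h4 := mul_le_mul_of_nonneg_right ih (by linarith : (0 : ℝ) ≤ a - 1)
    have h5 : ((r : ℝ) + 1) * (a - 1) ^ r * (a - 1) = (r + 1) * (a - 1) ^ (r + 1) := by ring
    nlinarith

theorem stmt_19 (r : ℕ) (hr : 1 ≤ r) :
    Filter.Tendsto
      (fun n : ℕ =>
        (({τs : Fin r → ℕ → ℕ → ℕ | (∀ m, IsMT n (τs m)) ∧ infTuple τs = tmin n}.ncard : ℝ)) /
          (r * (MTcount n : ℝ) ^ (r - 1)))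
      Filter.atTop (nhds 1) := by
  rw [← Filter.tendsto_add_atTop_iff_nat 2]
  obtain ⟨M, hM, hb⟩ := tt_bound r
  have hr0 : (0 : ℝ) < r := by exact_mod_cast hr
  have hlow : Filter.Tendsto (fun n : ℕ => (1 - 1 / (((n + 1 : ℕ) : ℝ) + 1)) ^ (r - 1))
      Filter.atTop (nhds 1) := by
    have h := ((tendsto_one_div_add_atTop_nhds_zero_nat (𝕜 := ℝ)).comp
      (Filter.tendsto_add_atTop_nat 1)).const_sub 1 |>.pow (r - 1)
    simpa using h
  have hup : Filter.Tendsto (fun n : ℕ => 1 + M / r * (1 / (((n + 1 : ℕ) : ℝ) + 1)))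
      Filter.atTop (nhds 1) := by
    have h := ((tendsto_one_div_add_atTop_nhds_zero_nat (𝕜 := ℝ)).comp
      (Filter.tendsto_add_atTop_nat 1)).const_mul (M / r) |>.const_add 1
    simpa using h
  refine tendsto_of_tendsto_of_tendsto_of_le_of_le hlow hup ?_ ?_
  · intro n
    have hA := MTpos (n + 2)
    have h1 := covT_lower r (n + 2) hr
    have hA1 : (1 : ℝ) ≤ MTcount (n + 2) := by exact_mod_cast MTcount_pos (n + 2)
    have hge : ((n : ℝ) + 2) ≤ MTcount (n + 2) := by exact_mod_cast MTcount_ge (n + 2)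
    have h2 : (MTcount (n + 2) : ℝ) ^ r ≤ (covT r (n + 2)).ncard + ((MTcount (n + 2) : ℝ) - 1) ^ r := by
      have : (MTcount (n + 2) : ℝ) ^ r ≤
          (covT r (n + 2)).ncard + ((MTcount (n + 2) - 1 : ℕ) : ℝ) ^ r := by exact_mod_cast h1
      rwa [Nat.cast_sub (MTcount_pos _), Nat.cast_one] at this
    have h3 := pow_diff _ hA1 (r - 1)
    rw [Nat.sub_add_cancel hr, Nat.cast_sub hr, Nat.cast_one, sub_add_cancel] at h3
    change (1 - 1 / (((n + 1 : ℕ) : ℝ) + 1)) ^ (r - 1) ≤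
      ((covT r (n + 2)).ncard : ℝ) / (r * (MTcount (n + 2) : ℝ) ^ (r - 1))
    rw [le_div_iff₀ (by positivity)]
    have h4 : (1 - 1 / (((n + 1 : ℕ) : ℝ) + 1)) * MTcount (n + 2) ≤ MTcount (n + 2) - 1 := by
      have : 1 ≤ 1 / (((n + 1 : ℕ) : ℝ) + 1) * MTcount (n + 2) := by
        rw [one_div_mul_eq_div, one_le_div (by positivity)]
        push_cast; linarith
      linarith
    have h5 : 0 ≤ 1 - 1 / (((n + 1 : ℕ) : ℝ) + 1) := by
      rw [sub_nonneg, div_le_one (by positivity)]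
      have : (0 : ℝ) ≤ ((n + 1 : ℕ) : ℝ) := by positivity
      linarith
    have h6 := pow_le_pow_left₀ (mul_nonneg h5 hA.le) h4 (r - 1)
    rw [mul_pow] at h6
    nlinarith
  · intro n
    have hA := MTpos (n + 2)
    have h1 := covT_upper r (n + 1) hr
    have h2 := hb n
    change ((covT r (n + 2)).ncard : ℝ) / (r * (MTcount (n + 2) : ℝ) ^ (r - 1)) ≤
      1 + M / r * (1 / (((n + 1 : ℕ) : ℝ) + 1))
    rw [div_le_iff₀ (by positivity)]
    have h3 := mul_le_mul_of_nonneg_left h2 (pow_nonneg hA.le (r - 1))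
    refine h1.trans (h3.trans (le_of_eq ?_))
    push_cast
    field_simp
    ring
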